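/- Let V be a real vector space with finrank V = 2n (n ≥ 1), ω a nondegenerate alternating bilinear form on V, L ≤ V a Lagrangian subspace and Y ≤ V a hyperplane with L ⊔ Y = ⊤. Then Y ⊓ (L ⊓ Y)^⊥ = (L ⊓ Y) ⊔ Y^⊥; equivalently, the image of the slice L ⊓ Y in the linear symplectic reduction Y / (Y ⊓ Y^⊥) is a Lagrangian subspace of the reduced symplectic vector space. -/

import Mathlib

/-- The `ω`-orthogonal of a subspace `W`: all `v` with `ω v w = 0` for every `w ∈ W`. -/
def orth {V : Type*} [AddCommGroup V] [Module ℝ V]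
    (ω : V →ₗ[ℝ] V →ₗ[ℝ] ℝ) (W : Submodule ℝ V) : Submodule ℝ V where
  carrier := {v | ∀ w ∈ W, ω v w = 0}
  zero_mem' := by intro w hw; simp
  add_mem' := by intro a b ha hb w hw; simp [ha w hw, hb w hw]
  smul_mem' := by intro c a ha w hw; simp [ha w hw]

/-- For an alternating form, `orth` is Mathlib's bilinear-form orthogonal. -/
lemma orth_eq_orthogonal {V : Type*} [AddCommGroup V] [Module ℝ V]
    {ω : V →ₗ[ℝ] V →ₗ[ℝ] ℝ} (halt : ∀ v, ω v v = 0) (W : Submodule ℝ V) :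
    orth ω W = LinearMap.BilinForm.orthogonal ω W := by
  have hrefl : LinearMap.BilinForm.IsAlt ω := halt
  ext v
  exact forall₂_congr fun w _ => hrefl.eq_iff

/-- An alternating form is isotropic on any line. -/
lemma apply_eq_zero_of_finrank_eq_one {V : Type*} [AddCommGroup V] [Module ℝ V]
    {ω : V →ₗ[ℝ] V →ₗ[ℝ] ℝ} (halt : ∀ v, ω v v = 0) {W : Submodule ℝ V}
    (hW : Module.finrank ℝ W = 1) {x y : V} (hx : x ∈ W) (hy : y ∈ W) : ω x y = 0 := by
  obtain ⟨v, -, hv⟩ := finrank_eq_one_iff'.mp hW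
  obtain ⟨a, ha⟩ := hv ⟨x, hx⟩
  obtain ⟨b, hb⟩ := hv ⟨y, hy⟩
  have hxa : a • (v : V) = x := congrArg Subtype.val ha
  have hyb : b • (v : V) = y := congrArg Subtype.val hb
  simp [← hxa, ← hyb, halt]

/-- If a Lagrangian `L` is transverse to a hyperplane `Y`, then
`Y ⊓ (L ⊓ Y)^⊥ = (L ⊓ Y) ⊔ Y^⊥`; equivalently, the image of the slice `L ⊓ Y` in the
linear symplectic reduction `Y / (Y ⊓ Y^⊥)` is Lagrangian. -/
theorem stmt3 {V : Type*} [AddCommGroup V] [Module ℝ V] [FiniteDimensional ℝ V]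
    (n : ℕ) (hn : 1 ≤ n) (hV : Module.finrank ℝ V = 2 * n)
    (ω : V →ₗ[ℝ] V →ₗ[ℝ] ℝ)
    (halt : ∀ v, ω v v = 0)
    (hnd : ∀ v, (∀ w, ω v w = 0) → v = 0)
    (L : Submodule ℝ V) (hL : orth ω L = L)
    (Y : Submodule ℝ V) (hY : Module.finrank ℝ Y = 2 * n - 1)
    (hT : L ⊔ Y = ⊤) :
    Y ⊓ orth ω (L ⊓ Y) = (L ⊓ Y) ⊔ orth ω Y := by
  have hrefl : LinearMap.BilinForm.IsRefl ω := LinearMap.BilinForm.IsAlt.isRefl halt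
  have hB : LinearMap.BilinForm.Nondegenerate ω :=
    ⟨hnd, fun v hv => hnd v fun w => hrefl w v (hv w)⟩
  have horth : ∀ W, orth ω (orth ω W) = W := fun W => by
    rw [orth_eq_orthogonal halt, orth_eq_orthogonal halt]
    exact LinearMap.BilinForm.orthogonal_orthogonal hB hrefl W
  have hfin : Module.finrank ℝ (orth ω Y) = 1 := by
    rw [orth_eq_orthogonal halt, LinearMap.BilinForm.finrank_orthogonal hB, hV, hY]
    omega
  have hle : orth ω Y ≤ Y := by
    conv_rhs => rw [← horth Y]
    exact fun x hx y hy => apply_eq_zero_of_finrank_eq_one halt hfin hx hy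
  have hslice : L ⊓ Y = orth ω (L ⊔ orth ω Y) := by
    apply le_antisymm
    · rintro x ⟨hxL, hxY⟩ w hw
      obtain ⟨l, hl, y, hy, rfl⟩ := Submodule.mem_sup.mp hw
      rw [← hL] at hxL
      rw [map_add, hxL l hl, hrefl y x (hy x hxY), add_zero]
    · intro x hx
      refine ⟨?_, ?_⟩
      · rw [← hL]
        exact fun w hw => hx w (Submodule.mem_sup_left hw)
      · rw [← horth Y]
        exact fun w hw => hx w (Submodule.mem_sup_right hw)
  conv_lhs => rw [hslice, horth]
  rw [sup_comm L, inf_comm, sup_inf_assoc_of_le L hle, sup_comm]
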